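/- Let m ≥ 1, let α₁,…,α_m be real numbers with 0 < α_i < Q for each i, and let α = α₁+⋯+α_m. Then for all f_i ∈ H^∞_{α_i}(ℍⁿ), ‖P_m^h(f₁,…,f_m)‖_{H^∞_α} ≤ ℬ_m^h ∏_{i=1}^m ‖f_i‖_{H^∞_{α_i}}, where ℬ_m^h := ∫_{(ℝ^{2n+1})^m} (∏_{i=1}^m |y_i|_h^{-α_i}) / [max(1, |y₁|_h^Q, …, |y_m|_h^Q)]^m dy₁⋯dy_m < ∞; in particular the m-linear Hardy–Littlewood–Pólya operator P_m^h is bounded from H^∞_{α₁}(ℍⁿ)×⋯×H^∞_{α_m}(ℍⁿ) to H^∞_α(ℍⁿ). -/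

import Mathlib

open MeasureTheory ENNReal

/-- The Korányi (homogeneous) norm on the Heisenberg group `ℍⁿ ≃ ℝ^{2n+1}`. -/
noncomputable def hnorm (n : ℕ) (x : Fin (2*n+1) → ℝ) : ℝ :=
  ((∑ i : Fin (2*n+1), if (i : ℕ) < 2*n then (x i)^2 else 0)^2
    + (x (Fin.last (2*n)))^2) ^ ((1:ℝ)/4)

/-- The Heisenberg dilations `δ_r`. -/
noncomputable def dil (n : ℕ) (r : ℝ) (x : Fin (2*n+1) → ℝ) : Fin (2*n+1) → ℝ :=
  fun i => if (i : ℕ) < 2*n then r * x i else r^2 * x i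

/-- The norm of the weighted-type space `H^∞_α(ℍⁿ)`:
`‖f‖ = ess sup_x |x|_h^α |f x|`. -/
noncomputable def wnorm (n : ℕ) (α : ℝ) (f : (Fin (2*n+1) → ℝ) → ℝ) : ℝ≥0∞ :=
  essSup (fun x => ENNReal.ofReal (hnorm n x ^ α * |f x|)) volume

/-- `Ω_Q`: the volume of the Korányi unit ball. -/
noncomputable def ΩQ (n : ℕ) : ℝ :=
  (volume {x : Fin (2*n+1) → ℝ | hnorm n x < 1}).toReal

lemma hnorm_nonneg (n : ℕ) (x : Fin (2*n+1) → ℝ) : 0 ≤ hnorm n x := by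
  unfold hnorm; positivity

lemma hnorm_pow_four (n : ℕ) (x : Fin (2*n+1) → ℝ) : hnorm n x ^ 4 =
    (∑ i : Fin (2*n+1), if (i : ℕ) < 2*n then (x i)^2 else 0)^2 + (x (Fin.last (2*n)))^2 := by
  unfold hnorm
  rw [← Real.rpow_natCast, ← Real.rpow_mul (by positivity)]
  norm_num

lemma measurable_hnorm (n : ℕ) : Measurable (hnorm n) := by
  unfold hnorm
  refine Measurable.pow_const ?_ _
  refine Measurable.add (Measurable.pow_const (Finset.measurable_sum _ fun i _ => ?_) _) (by fun_prop)
  split_ifs <;> fun_prop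

lemma hnorm_dil (n : ℕ) (r : ℝ) (hr : 0 ≤ r) (x : Fin (2*n+1) → ℝ) :
    hnorm n (dil n r x) = r * hnorm n x := by
  have h : hnorm n (dil n r x) ^ 4 = (r * hnorm n x) ^ 4 := by
    rw [mul_pow, hnorm_pow_four, hnorm_pow_four]
    have : (∑ i : Fin (2*n+1), if (i : ℕ) < 2*n then (dil n r x i)^2 else 0)
        = r^2 * ∑ i : Fin (2*n+1), if (i : ℕ) < 2*n then (x i)^2 else 0 := by
      rw [Finset.mul_sum]
      refine Finset.sum_congr rfl fun i _ => ?_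
      split_ifs with h
      · simp [dil, h]; ring
      · simp
    rw [this]
    simp [dil]; ring
  exact (pow_left_inj₀ (hnorm_nonneg _ _) (mul_nonneg hr (hnorm_nonneg _ _)) (by norm_num)).1 h

/-- the side lengths of the Korányi box -/
noncomputable def sc (n : ℕ) (r : ℝ) (i : Fin (2*n+1)) : ℝ := if (i : ℕ) < 2*n then r else r^2

lemma sc_prod (n : ℕ) (r : ℝ) : ∏ i, sc n r i = r ^ (2*n+2) := by
  rw [Fin.prod_univ_castSucc]
  simp [sc]; ring

lemma abs_le_sc (n : ℕ) (x : Fin (2*n+1) → ℝ) (i : Fin (2*n+1)) : |x i| ≤ sc n (hnorm n x) i := by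
  have h4 := hnorm_pow_four n x
  have hN := hnorm_nonneg n x
  set S := (∑ i : Fin (2*n+1), if (i : ℕ) < 2*n then (x i)^2 else 0) with hS
  have hS0 : 0 ≤ S := Finset.sum_nonneg fun i _ => by split_ifs <;> positivity
  unfold sc
  split_ifs with h
  · have h1 : (x i)^2 ≤ S := by
      have := Finset.single_le_sum (f := fun i : Fin (2*n+1) => if (i : ℕ) < 2*n then (x i)^2 else 0)
        (fun i _ => by split_ifs <;> positivity) (Finset.mem_univ i)
      simpa [h] using this
    have h2 : S ≤ hnorm n x ^ 2 := abs_le_of_sq_le_sq' (by nlinarith [sq_nonneg (x (Fin.last (2*n)))]) (by positivity) |>.2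
    exact abs_le_of_sq_le_sq (h1.trans h2) hN
  · have : i = Fin.last (2*n) := by
      ext; simp; omega
    subst this
    exact abs_le_of_sq_le_sq (by nlinarith [sq_nonneg S]) (by positivity)

lemma ae_hnorm_pos (n : ℕ) : ∀ᵐ x : Fin (2*n+1) → ℝ, 0 < hnorm n x := by
  have : ∀ᵐ x : Fin (2*n+1) → ℝ, x ≠ 0 := by
    simp [ae_iff]
  filter_upwards [this] with x hx
  refine lt_of_le_of_ne (hnorm_nonneg n x) fun h => hx ?_
  ext i
  have := abs_le_sc n x i
  rw [← h] at this
  simpa [sc] using this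

lemma vol_ball_le (n : ℕ) (R : ℝ) (hR : 0 ≤ R) :
    volume {x : Fin (2*n+1) → ℝ | hnorm n x < R} ≤ ENNReal.ofReal (2^(2*n+1) * R^(2*n+2)) := by
  have hs : {x : Fin (2*n+1) → ℝ | hnorm n x < R} ⊆ Set.Icc (fun i => - sc n R i) (sc n R) := by
    intro x hx
    have hx : hnorm n x < R := hx
    have h : ∀ i, |x i| ≤ sc n R i := fun i => (abs_le_sc n x i).trans (by
      unfold sc; have := hnorm_nonneg n x
      split_ifs
      · exact hx.le
      · gcongr)
    exact ⟨fun i => (abs_le.1 (h i)).1, fun i => (abs_le.1 (h i)).2⟩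
  refine (measure_mono hs).trans (le_of_eq ?_)
  rw [Real.volume_Icc_pi, ← ENNReal.ofReal_prod_of_nonneg, ← sc_prod]
  · congr 1
    rw [show (2:ℝ)^(2*n+1) = ∏ _i : Fin (2*n+1), (2:ℝ) by simp, ← Finset.prod_mul_distrib]
    exact Finset.prod_congr rfl fun i _ => by ring
  · intro i _
    unfold sc; split_ifs <;> nlinarith

lemma measurable_dil (n : ℕ) (r : ℝ) : Measurable (dil n r) := by
  refine measurable_pi_lambda _ fun i => ?_
  unfold dil
  split_ifs <;> fun_prop

lemma map_dil (n : ℕ) (r : ℝ) (hr : 0 < r) :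
    ENNReal.ofReal (r^(2*n+2)) • Measure.map (dil n r) volume = volume := by
  have h0 : (Matrix.diagonal (sc n r)).det = r^(2*n+2) := by rw [Matrix.det_diagonal, sc_prod]
  have := Real.smul_map_diagonal_volume_pi (D := sc n r) (by rw [h0]; positivity)
  rw [h0, abs_of_pos (by positivity)] at this
  convert this using 3
  ext x i
  simp [dil, sc, Matrix.toLin'_apply, Matrix.mulVec_diagonal]

/-- dilation on the product -/
noncomputable def pdil (n m : ℕ) (r : ℝ) (y : Fin m → Fin (2*n+1) → ℝ) : Fin m → Fin (2*n+1) → ℝ :=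
  fun i => dil n r (y i)

lemma measurable_pdil (n m : ℕ) (r : ℝ) : Measurable (pdil n m r) :=
  measurable_pi_lambda _ fun i => (measurable_dil n r).comp (measurable_pi_apply i)

lemma map_pdil (n m : ℕ) (r : ℝ) (hr : 0 < r) :
    ENNReal.ofReal (r^(2*n+2)) ^ m • Measure.map (pdil n m r) volume
      = (volume : Measure (Fin m → Fin (2*n+1) → ℝ)) := by
  symm
  rw [volume_pi]
  refine Measure.pi_eq fun s hs => ?_
  rw [Measure.smul_apply, Measure.map_apply (measurable_pdil n m r) (MeasurableSet.univ_pi hs)]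
  have : pdil n m r ⁻¹' (Set.univ.pi s) = Set.univ.pi fun i => dil n r ⁻¹' (s i) := by
    ext y; simp [pdil]
  rw [this, Measure.pi_pi, smul_eq_mul]
  have h2 : ∀ i, volume (s i) = ENNReal.ofReal (r^(2*n+2)) * volume (dil n r ⁻¹' (s i)) := by
    intro i
    conv_lhs => rw [← map_dil n r hr]
    rw [Measure.smul_apply, Measure.map_apply (measurable_dil n r) (hs i), smul_eq_mul]
  rw [Finset.prod_congr rfl fun i _ => h2 i, Finset.prod_mul_distrib]
  simp

lemma one_integrable (n : ℕ) (Q a : ℝ) (hQ : Q = 2*n+2) (ha : 0 < a) (haQ : a < Q) :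
    Integrable (fun y : Fin (2*n+1) → ℝ => hnorm n y ^ (-a) / max 1 (hnorm n y ^ Q)) := by
  have hm : Measurable (fun y : Fin (2*n+1) → ℝ => hnorm n y ^ (-a) / max 1 (hnorm n y ^ Q)) := by
    have := measurable_hnorm n
    fun_prop
  have hQ0 : 0 < Q := by linarith
  have hnn : ∀ y : Fin (2*n+1) → ℝ, 0 ≤ hnorm n y ^ (-a) / max 1 (hnorm n y ^ Q) := fun y => by
    have := hnorm_nonneg n y
    positivity
  refine ⟨hm.aestronglyMeasurable, ?_⟩
  rw [hasFiniteIntegral_iff_ofReal (Filter.Eventually.of_forall hnn),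
    lintegral_eq_lintegral_meas_lt _ (Filter.Eventually.of_forall hnn) hm.aemeasurable]
  -- pointwise facts
  have hball : ∀ t p : ℝ, 0 < t → volume {x : Fin (2*n+1) → ℝ | hnorm n x < t ^ (-p)}
      ≤ ENNReal.ofReal (2^(2*n+1) * t ^ (-(p*Q))) := by
    intro t p ht
    refine (vol_ball_le n _ (by positivity)).trans (le_of_eq ?_)
    congr 2
    rw [← Real.rpow_natCast, ← Real.rpow_mul ht.le, hQ]
    push_cast; ring_nf
  have hsmall : ∀ t ∈ Set.Ioc (0:ℝ) 1, volume {y : Fin (2*n+1) → ℝ | t < hnorm n y ^ (-a) / max 1 (hnorm n y ^ Q)}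
      ≤ ENNReal.ofReal (2^(2*n+1) * t ^ (-((1/(a+Q))*Q))) := by
    intro t ⟨ht, ht1⟩
    refine le_trans (measure_mono ?_) (hball t (1/(a+Q)) ht)
    intro y hy
    simp only [Set.mem_ofPred_eq] at hy ⊢
    have hN := hnorm_nonneg n y
    set N := hnorm n y
    have h1 : 1 ≤ t ^ (-(1/(a+Q))) :=
      Real.one_le_rpow_of_pos_of_le_one_of_nonpos ht ht1 (by simp; positivity)
    by_contra! hcon
    have hN1 : 1 ≤ N := h1.trans hcon
    have hN0 : 0 < N := by linarith
    have h2 : N ^ (-a) / max 1 (N ^ Q) ≤ N ^ (-(a+Q)) := by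
      rw [neg_add, Real.rpow_add hN0, div_eq_mul_inv, Real.rpow_neg hN Q]
      gcongr
      exact le_max_right _ _
    have h3 : N ^ (-(a+Q)) ≤ (t ^ (-(1/(a+Q)))) ^ (-(a+Q)) :=
      Real.rpow_le_rpow_of_nonpos (by positivity) hcon (by linarith)
    rw [← Real.rpow_mul ht.le, show -(1/(a+Q)) * -(a+Q) = 1 by field_simp, Real.rpow_one] at h3
    linarith
  have hlarge : ∀ t ∈ Set.Ioi (1:ℝ), volume {y : Fin (2*n+1) → ℝ | t < hnorm n y ^ (-a) / max 1 (hnorm n y ^ Q)}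
      ≤ ENNReal.ofReal (2^(2*n+1) * t ^ (-((1/a)*Q))) := by
    intro t ht1
    have ht1 : 1 < t := ht1
    have ht : 0 < t := by linarith
    refine le_trans (measure_mono ?_) (hball t (1/a) ht)
    intro y hy
    simp only [Set.mem_ofPred_eq] at hy ⊢
    have hN := hnorm_nonneg n y
    set N := hnorm n y
    by_contra! hcon
    have h2 : N ^ (-a) / max 1 (N ^ Q) ≤ N ^ (-a) := 
      div_le_self (by positivity) (le_max_left _ _)
    have h3 : N ^ (-a) ≤ (t ^ (-(1/a))) ^ (-a) :=
      Real.rpow_le_rpow_of_nonpos (by positivity) hcon (by linarith)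
    rw [← Real.rpow_mul ht.le, show -(1/a) * -a = 1 by field_simp, Real.rpow_one] at h3
    linarith
  rw [← Set.Ioc_union_Ioi_eq_Ioi (zero_le_one : (0:ℝ) ≤ 1)]
  refine (lintegral_union_le _ _ _).trans_lt (ENNReal.add_lt_top.2 ⟨?_, ?_⟩)
  · refine (setLIntegral_mono' measurableSet_Ioc hsmall).trans_lt ?_
    have : IntegrableOn (fun t : ℝ => 2^(2*n+1) * t ^ (-((1/(a+Q))*Q))) (Set.Ioc 0 1) := by
      refine Integrable.const_mul ?_ _
      rw [← IntegrableOn, integrableOn_Ioc_iff_integrableOn_Ioo,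
        intervalIntegral.integrableOn_Ioo_rpow_iff one_pos]
      rw [neg_lt_neg_iff, one_div_mul_eq_div, div_lt_one] <;> linarith
    exact this.setLIntegral_lt_top
  · refine (setLIntegral_mono' measurableSet_Ioi hlarge).trans_lt ?_
    have : IntegrableOn (fun t : ℝ => 2^(2*n+1) * t ^ (-((1/a)*Q))) (Set.Ioi 1) := by
      refine Integrable.const_mul ?_ _
      rw [← IntegrableOn, integrableOn_Ioi_rpow_iff one_pos]
      rw [neg_lt_neg_iff, one_div_mul_eq_div, one_lt_div] <;> linarith
    exact this.setLIntegral_lt_top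

/-- the kernel -/
noncomputable def ker (n m : ℕ) (Q : ℝ) (α : Fin m → ℝ) (R : ℝ) (y : Fin m → Fin (2*n+1) → ℝ) : ℝ :=
  (∏ i, hnorm n (y i) ^ (-(α i))) / (max R (⨆ i, hnorm n (y i) ^ Q)) ^ m

lemma measurable_ker (n m : ℕ) (Q : ℝ) (α : Fin m → ℝ) (R : ℝ) : Measurable (ker n m Q α R) := by
  have h := fun i : Fin m => (measurable_hnorm n).comp (measurable_pi_apply (X := fun _ : Fin m => Fin (2*n+1) → ℝ) i)
  unfold ker
  refine Measurable.div (Finset.measurable_prod _ fun i _ => (h i).pow_const _) ?_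
  refine (measurable_const.max (Measurable.iSup fun i => (h i).pow_const _)).pow_const _

lemma ker_nonneg (n m : ℕ) (Q : ℝ) (α : Fin m → ℝ) (R : ℝ) (hR : 0 ≤ R) (y : Fin m → Fin (2*n+1) → ℝ) :
    0 ≤ ker n m Q α R y := by
  unfold ker
  refine div_nonneg (Finset.prod_nonneg fun i _ => Real.rpow_nonneg (hnorm_nonneg _ _) _) (pow_nonneg (le_max_of_le_left hR) _)

lemma ker_integrable (n m : ℕ) (Q : ℝ) (hQ : Q = 2*n+2)
    (α : Fin m → ℝ) (hα : ∀ i, 0 < α i ∧ α i < Q) : Integrable (ker n m Q α 1) := by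
  have h := Integrable.fintype_prod (μ := fun _ : Fin m => (volume : Measure (Fin (2*n+1) → ℝ)))
    fun i => one_integrable n Q (α i) hQ (hα i).1 (hα i).2
  rw [← volume_pi] at h
  refine h.mono' (measurable_ker ..).aestronglyMeasurable (Filter.Eventually.of_forall fun y => ?_)
  rw [Real.norm_of_nonneg (ker_nonneg _ _ _ _ _ zero_le_one _), Finset.prod_div_distrib]
  unfold ker
  refine div_le_div_of_nonneg_left (Finset.prod_nonneg fun i _ => Real.rpow_nonneg (hnorm_nonneg _ _) _)
    (Finset.prod_pos fun i _ => by positivity) ?_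
  calc _ ≤ ∏ _i : Fin m, max 1 (⨆ i, hnorm n (y i) ^ Q) :=
        Finset.prod_le_prod (fun i _ => by positivity) fun i _ =>
          max_le_max_left _ (le_ciSup (f := fun i => hnorm n (y i) ^ Q) (Set.finite_range _).bddAbove i)
    _ = _ := by simp

lemma ker_pdil (n m : ℕ) (Q : ℝ) (α : Fin m → ℝ) (r : ℝ) (hr : 0 < r) (y : Fin m → Fin (2*n+1) → ℝ) :
    ker n m Q α (r ^ Q) (pdil n m r y) = (r ^ (-∑ i, α i) * ((r ^ Q) ^ m)⁻¹) * ker n m Q α 1 y := by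
  unfold ker pdil
  have h1 : ∀ (i : Fin m) (p : ℝ), hnorm n (dil n r (y i)) ^ p = r ^ p * hnorm n (y i) ^ p := fun i p => by
    rw [hnorm_dil n r hr.le, Real.mul_rpow hr.le (hnorm_nonneg _ _)]
  simp only [h1]
  rw [Finset.prod_mul_distrib, ← Real.mul_iSup_of_nonneg (by positivity),
    ← Real.rpow_sum_of_pos hr, Finset.sum_neg_distrib]
  have : max (r ^ Q) (r ^ Q * ⨆ i, hnorm n (y i) ^ Q) = r ^ Q * max 1 (⨆ i, hnorm n (y i) ^ Q) := by
    rw [mul_max_of_nonneg _ _ (by positivity), mul_one]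
  rw [this, mul_pow]
  field_simp

lemma ker_scale (n m : ℕ) (Q : ℝ) (hQ : Q = 2*n+2)
    (α : Fin m → ℝ) (hα : ∀ i, 0 < α i ∧ α i < Q) (r : ℝ) (hr : 0 < r) :
    Integrable (ker n m Q α (r ^ Q)) ∧
      ∫ y, ker n m Q α (r ^ Q) y = r ^ (-∑ i, α i) * ∫ y, ker n m Q α 1 y := by
  have hI := ker_integrable n m Q hQ α hα
  have hm := measurable_ker n m Q α (r ^ Q)
  have hc : ker n m Q α (r ^ Q) ∘ pdil n m r = fun y => (r ^ (-∑ i, α i) * ((r ^ Q) ^ m)⁻¹) * ker n m Q α 1 y :=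
    funext fun y => ker_pdil n m Q α r hr y
  have hrQ : r ^ (2*n+2) = r ^ Q := by
    rw [hQ, ← Real.rpow_natCast]; push_cast; rfl
  constructor
  · rw [← map_pdil n m r hr]
    refine Integrable.smul_measure ?_ (by simp)
    rw [integrable_map_measure hm.aestronglyMeasurable (measurable_pdil n m r).aemeasurable, hc]
    exact hI.const_mul _
  · conv_lhs => rw [← map_pdil n m r hr]
    rw [integral_smul_measure, integral_map (measurable_pdil n m r).aemeasurable hm.aestronglyMeasurable]
    rw [show (fun y => ker n m Q α (r ^ Q) (pdil n m r y)) = _ from hc, integral_const_mul]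
    rw [ENNReal.toReal_pow, ENNReal.toReal_ofReal (by positivity), hrQ, smul_eq_mul]
    have : 0 < r ^ Q := by positivity
    field_simp

/-- boundedness of the `m`-linear Hardy–Littlewood–Pólya operator on the
Heisenberg group from `H^∞_{α₁} × ⋯ × H^∞_{α_m}` to `H^∞_α`, with finite constant
`ℬ_m^h`. -/
theorem statement10 (n : ℕ) (hn : 1 ≤ n) (m : ℕ) (hm : 1 ≤ m)
    (Q : ℝ) (hQ : Q = 2*n+2)
    (α : Fin m → ℝ) (hα : ∀ i, 0 < α i ∧ α i < Q)
    (B : ℝ)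
    (hB : B = ∫ y : Fin m → Fin (2*n+1) → ℝ,
      (∏ i, hnorm n (y i) ^ (-(α i))) / (max 1 (⨆ i, hnorm n (y i) ^ Q)) ^ m)
    (f : Fin m → (Fin (2*n+1) → ℝ) → ℝ)
    (hfmeas : ∀ i, Measurable (f i))
    (hfnonneg : ∀ i, ∀ y, 0 ≤ f i y)
    (hffin : ∀ i, wnorm n (α i) (f i) < ⊤) :
    Integrable (fun y : Fin m → Fin (2*n+1) → ℝ =>
      (∏ i, hnorm n (y i) ^ (-(α i))) / (max 1 (⨆ i, hnorm n (y i) ^ Q)) ^ m) ∧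
    wnorm n (∑ i, α i)
        (fun x => ∫ y : Fin m → Fin (2*n+1) → ℝ,
          (∏ i, f i (y i)) / (max (hnorm n x ^ Q) (⨆ i, hnorm n (y i) ^ Q)) ^ m)
      ≤ ENNReal.ofReal B * ∏ i, wnorm n (α i) (f i) := by
  have hI := ker_integrable n m Q hQ α hα
  refine ⟨hI, ?_⟩
  have hB' : B = ∫ y, ker n m Q α 1 y := hB
  have hB0 : 0 ≤ B := by
    rw [hB']; exact integral_nonneg fun y => ker_nonneg _ _ _ _ _ zero_le_one _
  have hsum : 0 < ∑ i, α i :=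
    Finset.sum_pos (fun i _ => (hα i).1) ⟨⟨0, hm⟩, Finset.mem_univ _⟩
  set C : Fin m → ℝ := fun i => (wnorm n (α i) (f i)).toReal with hC
  have hCw : ∀ i, wnorm n (α i) (f i) = ENNReal.ofReal (C i) := fun i =>
    (ENNReal.ofReal_toReal (hffin i).ne).symm
  have hC0 : ∀ i, 0 ≤ C i := fun i => ENNReal.toReal_nonneg
  have hfb : ∀ i, ∀ᵐ x : Fin (2*n+1) → ℝ, f i x ≤ C i * hnorm n x ^ (-(α i)) := by
    intro i
    filter_upwards [ENNReal.ae_le_essSup (μ := volume)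
      (fun x => ENNReal.ofReal (hnorm n x ^ (α i) * |f i x|)), ae_hnorm_pos n] with x hx hpos
    change _ ≤ wnorm n (α i) (f i) at hx
    rw [hCw i, ENNReal.ofReal_le_ofReal_iff (hC0 i), abs_of_nonneg (hfnonneg i x)] at hx
    rw [Real.rpow_neg hpos.le, ← div_eq_mul_inv, le_div_iff₀ (by positivity)]
    linarith
  have hall : ∀ᵐ y : Fin m → Fin (2*n+1) → ℝ, ∀ i, f i (y i) ≤ C i * hnorm n (y i) ^ (-(α i)) := by
    rw [ae_all_iff]
    intro i
    exact (Measure.quasiMeasurePreserving_eval (fun _ : Fin m => (volume : Measure (Fin (2*n+1) → ℝ))) i).ae (hfb i)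
  refine essSup_le_of_ae_le _ (Filter.Eventually.of_forall fun x => ?_)
  dsimp only
  simp only [hCw]
  rw [← ENNReal.ofReal_prod_of_nonneg (fun i _ => hC0 i), ← ENNReal.ofReal_mul hB0]
  refine ENNReal.ofReal_le_ofReal ?_
  have hP0 : 0 ≤ ∏ i, C i := Finset.prod_nonneg fun i _ => hC0 i
  rcases (hnorm_nonneg n x).eq_or_lt with h0 | hr
  · rw [← h0, Real.zero_rpow hsum.ne', zero_mul]
    positivity
  set r := hnorm n x
  obtain ⟨hi, hs⟩ := ker_scale n m Q hQ α hα r hr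
  have hnn : ∀ y : Fin m → Fin (2*n+1) → ℝ,
      0 ≤ (∏ i, f i (y i)) / (max (r ^ Q) (⨆ i, hnorm n (y i) ^ Q)) ^ m := fun y =>
    div_nonneg (Finset.prod_nonneg fun i _ => hfnonneg i _) (by positivity)
  have hle : ∫ y : Fin m → Fin (2*n+1) → ℝ,
      (∏ i, f i (y i)) / (max (r ^ Q) (⨆ i, hnorm n (y i) ^ Q)) ^ m
      ≤ ∫ y, (∏ i, C i) * ker n m Q α (r ^ Q) y := by
    refine integral_mono_of_nonneg (Filter.Eventually.of_forall hnn) (hi.const_mul _) ?_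
    filter_upwards [hall] with y hy
    unfold ker
    rw [← mul_div_assoc, ← Finset.prod_mul_distrib]
    gcongr with i
    · exact fun i _ => hfnonneg i _
    · exact hy i
  rw [integral_const_mul, hs, ← hB'] at hle
  rw [abs_of_nonneg (integral_nonneg hnn)]
  calc _ ≤ r ^ (∑ i, α i) * ((∏ i, C i) * (r ^ (-∑ i, α i) * B)) := by gcongr
    _ = B * ∏ i, C i := by
      rw [Real.rpow_neg hr.le]
      have : 0 < r ^ (∑ i, α i) := by positivity
      field_simp
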